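/- Let (A^T, B)^T and (Ã^T, B̃)^T be jointly Gaussian where A = (A_1,…,A_K), each marginal vector (A^T,B)^T and (Ã^T,B̃)^T standard multivariate normal (mean zero, identity covariance). Set σ_AA = max_{k,l} |cov(A_k, Ã_l)|, σ_AB = max_k max(|cov(A_k, B̃)|, |cov(B, Ã_k)|), and assume σ_BB = |cov(B, B̃)| ≤ 1. Then for a multi-index a with |a| = a_0 and integer m ≥ 0: |E[H_a(A) H_m(B) H_a(Ã) H_m(B̃)]| ≤ (a_0! m!)^2 ∑_{r = max(a_0 - m, 0)}^{a_0} σ_AA^r σ_AB^{2(a_0 - r)} / (r! (a_0 - r)!^2 (m - a_0 + r)!), where H_a(A) = ∏_{k=1}^K H_{a[k]}(A_k). -/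

import Mathlib

open MeasureTheory Finset

/-- Probabilists' Hermite polynomial of degree `n`, evaluated at a real `x`. -/
noncomputable def hermiteEval (n : ℕ) (x : ℝ) : ℝ := Polynomial.aeval x (Polynomial.hermite n)

open ProbabilityTheory

/-- Moment recursion of the standard Gaussian distribution. -/
lemma integral_pow_succ_gaussianReal (n : ℕ) :
    ∫ x, x ^ (n + 1) ∂(gaussianReal 0 1) = n * ∫ x, x ^ (n - 1) ∂(gaussianReal 0 1) := by
  have hint (k : ℕ) : Integrable (fun x : ℝ => x ^ k * Real.exp (-x ^ 2 / 2)) := by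
    have h := integrable_rpow_mul_exp_neg_mul_sq (b := 1 / 2) (by norm_num) (s := k)
      (by have : (0 : ℝ) ≤ k := k.cast_nonneg
          linarith)
    simp only [Real.rpow_natCast] at h
    convert h using 4
    ring
  have hparts : ∫ x : ℝ, x ^ n * (x * Real.exp (-x ^ 2 / 2)) =
      -∫ x : ℝ, (n * x ^ (n - 1)) * (-Real.exp (-x ^ 2 / 2)) := by
    refine integral_mul_deriv_eq_deriv_mul_of_integrable (fun x _ => hasDerivAt_pow n x)
      (fun x _ => ?_) ?_ ?_ ?_
    · have h : HasDerivAt (fun x : ℝ => -x ^ 2 / 2) (-x) x :=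
        ((hasDerivAt_pow 2 x).fun_neg.div_const 2).congr_deriv (by simp; ring)
      exact h.exp.fun_neg.congr_deriv (by ring)
    · exact (hint (n + 1)).congr (.of_forall fun x => by simp only [Pi.mul_apply]; ring)
    · exact ((hint (n - 1)).const_mul (-n : ℝ)).congr
        (.of_forall fun x => by simp only [Pi.mul_apply]; ring)
    · exact (hint n).neg.congr (.of_forall fun x => by simp only [Pi.mul_apply, Pi.neg_apply]; ring)
  simp_rw [integral_gaussianReal_eq_integral_smul (one_ne_zero), gaussianPDFReal, smul_eq_mul,
    NNReal.coe_one, mul_one, sub_zero]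
  have e (k : ℕ) : ∫ x : ℝ, (√(2 * Real.pi))⁻¹ * Real.exp (-x ^ 2 / 2) * x ^ k =
      (√(2 * Real.pi))⁻¹ * ∫ x : ℝ, x ^ k * Real.exp (-x ^ 2 / 2) := by
    rw [← integral_const_mul]
    congr with x
    ring
  rw [e, e]
  simp only [mul_neg, integral_neg, neg_neg, mul_assoc, integral_const_mul] at hparts
  simp only [pow_succ _ n, mul_assoc]
  rw [hparts]
  ring

namespace MvPolynomial

variable {ι : Type*} [Fintype ι]

lemma eval_monomial_fintype (s : ι →₀ ℕ) (c : ℝ) (x : ι → ℝ) :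
    eval x (monomial s c) = c * ∏ i, x i ^ s i := by
  rw [eval_monomial, Finsupp.prod_fintype _ _ (by simp)]

lemma integrable_eval_pi_gaussianReal (p : MvPolynomial ι ℝ) :
    Integrable (fun x => eval x p) (Measure.pi fun _ : ι => gaussianReal 0 1) := by
  induction p using MvPolynomial.induction_on' with
  | monomial s c =>
    simp only [eval_monomial_fintype]
    refine (Integrable.fintype_prod (f := fun i (y : ℝ) => y ^ s i) fun i => ?_).const_mul c
    have h : MemLp id (s i : NNReal) (gaussianReal 0 1) := memLp_id_gaussianReal _
    by_cases hs : s i = 0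
    · simp [hs]
    · have := h.integrable_norm_pow' 
      refine (integrable_norm_iff (by fun_prop)).1 ?_
      simpa using this
  | add p q hp hq => simpa only [map_add] using hp.fun_add hq

/-- Gaussian integration by parts for polynomials of independent standard Gaussians. -/
lemma integral_X_mul_pi_gaussianReal (k : ι) (p : MvPolynomial ι ℝ) :
    ∫ x, eval x (X k * p) ∂(Measure.pi fun _ : ι => gaussianReal 0 1) =
      ∫ x, eval x (pderiv k p) ∂(Measure.pi fun _ : ι => gaussianReal 0 1) := by
  classical
  induction p using MvPolynomial.induction_on' with
  | monomial s c =>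
    have hmon (t : ι →₀ ℕ) (d : ℝ) :
        ∫ x, eval x (monomial t d) ∂(Measure.pi fun _ : ι => gaussianReal 0 1) =
          d * ∏ i, ∫ y, y ^ t i ∂(gaussianReal 0 1) := by
      simp only [eval_monomial_fintype, integral_const_mul]
      rw [integral_fintype_prod_eq_prod (f := fun i (y : ℝ) => y ^ t i)]
    rw [X, monomial_mul, one_mul, pderiv_monomial, hmon, hmon, ← mul_prod_erase _ _ (mem_univ k),
      ← mul_prod_erase _ _ (mem_univ k)]
    have h1 : ∏ i ∈ univ.erase k, ∫ y, y ^ (Finsupp.single k 1 + s : ι →₀ ℕ) i ∂(gaussianReal 0 1) =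
        ∏ i ∈ univ.erase k, ∫ y, y ^ s i ∂(gaussianReal 0 1) :=
      prod_congr rfl fun i hi => by simp [(ne_of_mem_erase hi).symm]
    have h2 : ∏ i ∈ univ.erase k, ∫ y, y ^ (s - Finsupp.single k 1 : ι →₀ ℕ) i ∂(gaussianReal 0 1) =
        ∏ i ∈ univ.erase k, ∫ y, y ^ s i ∂(gaussianReal 0 1) :=
      prod_congr rfl fun i hi => by simp [(ne_of_mem_erase hi).symm]
    rw [h1, h2]
    simp only [Finsupp.add_apply, Finsupp.single_eq_same, Finsupp.tsub_apply]
    rw [add_comm 1, integral_pow_succ_gaussianReal]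
    ring
  | add p q hp hq =>
    simp only [mul_add, map_add]
    rw [integral_add (integrable_eval_pi_gaussianReal _) (integrable_eval_pi_gaussianReal _),
      integral_add (integrable_eval_pi_gaussianReal _) (integrable_eval_pi_gaussianReal _), hp, hq]

/-- Chain rule for partial derivatives of polynomials. -/
lemma pderiv_aeval {σ τ R : Type*} [Fintype σ] [CommRing R] (g : σ → MvPolynomial τ R) (k : τ)
    (p : MvPolynomial σ R) :
    pderiv k (aeval g p) = ∑ j, aeval g (pderiv j p) * pderiv k (g j) := by
  classical
  induction p using MvPolynomial.induction_on with
  | C r => simp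
  | add p q hp hq => simp only [map_add, hp, hq, add_mul, sum_add_distrib]
  | mul_X p i hp =>
    simp only [map_mul, aeval_X, pderiv_mul, hp, map_add, pderiv_X, add_mul, sum_add_distrib,
      sum_mul, mul_assoc]
    congr 1
    · exact sum_congr rfl fun j _ => by ring
    · simp [Pi.single_apply, apply_ite]

/-- Linear change of variables in a polynomial. -/
noncomputable def linearSubst (M : Matrix ι ι ℝ) : MvPolynomial ι ℝ →ₐ[ℝ] MvPolynomial ι ℝ :=
  aeval fun i => ∑ k, C (M i k) * X k

lemma eval_linearSubst (M : Matrix ι ι ℝ) (x : ι → ℝ) (p : MvPolynomial ι ℝ) :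
    eval x (linearSubst M p) = eval (M.mulVec x) p := by
  induction p using MvPolynomial.induction_on with
  | C r => simp [linearSubst]
  | add p q hp hq => simp only [map_add, hp, hq]
  | mul_X p i hp =>
    rw [map_mul, map_mul, map_mul, hp, eval_X, linearSubst, aeval_X]
    simp [Matrix.mulVec, dotProduct]

end MvPolynomial

lemma derivative_hermite (n : ℕ) :
    Polynomial.derivative (Polynomial.hermite n) =
      (n : Polynomial ℤ) * Polynomial.hermite (n - 1) := by
  induction n with
  | zero => simp
  | succ n ih =>
    rw [Polynomial.hermite_succ, map_sub, Polynomial.derivative_mul, ih]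
    rcases n with _ | n
    · simp
    · rw [Polynomial.derivative_mul, Nat.add_sub_cancel, Nat.add_sub_cancel, Polynomial.hermite_succ]
      simp
      ring

section GaussianFamily

variable {ι Ω : Type*} [Fintype ι] [MeasurableSpace Ω] {P : Measure Ω}
  {W : ι → Ω → ℝ}

/-- A family of random variables is jointly centered Gaussian if all linear combinations are. -/
def IsCenteredGaussianFamily (W : ι → Ω → ℝ) (P : Measure Ω) : Prop :=
  ∀ c : ι → ℝ, ∃ v : NNReal, P.map (fun ω => ∑ i, c i * W i ω) = gaussianReal 0 v

namespace IsCenteredGaussianFamily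

lemma aemeasurable (h : IsCenteredGaussianFamily W P) (i : ι) : AEMeasurable (W i) P := by
  classical
  obtain ⟨v, hv⟩ := h (Pi.single i 1)
  refine AEMeasurable.of_map_ne_zero ?_
  have e : (fun ω => ∑ j, (Pi.single i 1 : ι → ℝ) j * W j ω) = W i := by
    ext ω
    simp [Pi.single_apply]
  rw [e] at hv
  rw [hv]
  exact NeZero.ne _

lemma memLp_two (h : IsCenteredGaussianFamily W P) (c : ι → ℝ) :
    MemLp (fun ω => ∑ i, c i * W i ω) 2 P := by
  obtain ⟨v, hv⟩ := h c
  have := h.aemeasurable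
  have hm : AEMeasurable (fun ω => ∑ i, c i * W i ω) P := by fun_prop
  have h2 : MemLp id 2 (P.map (fun ω => ∑ i, c i * W i ω)) := hv ▸ memLp_id_gaussianReal 2
  exact (memLp_map_measure_iff (by fun_prop) hm).1 h2

lemma memLp_two_apply (h : IsCenteredGaussianFamily W P) (i : ι) : MemLp (W i) 2 P := by
  classical
  convert h.memLp_two (Pi.single i 1) using 2 with ω
  simp [Pi.single_apply]

lemma integral_sq (h : IsCenteredGaussianFamily W P) (c : ι → ℝ) :
    ∫ ω, (∑ i, c i * W i ω) ^ 2 ∂P = ∑ i, ∑ j, c i * c j * ∫ ω, W i ω * W j ω ∂P := by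
  have hint (i j : ι) : Integrable (fun ω => W i ω * W j ω) P :=
    (h.memLp_two_apply i).integrable_mul (h.memLp_two_apply j)
  simp_rw [← integral_const_mul]
  simp_rw [← integral_finsetSum _ fun j _ => (hint _ j).const_mul _]
  rw [← integral_finsetSum]
  · congr with ω
    rw [sq, sum_mul_sum]
    exact sum_congr rfl fun i _ => sum_congr rfl fun j _ => by ring
  · exact fun i _ => integrable_finsetSum _ fun j _ => (hint i j).const_mul _

/-- The law of every linear combination is determined by the second moments. -/
lemma map_eq (h : IsCenteredGaussianFamily W P) (c : ι → ℝ) :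
    P.map (fun ω => ∑ i, c i * W i ω) =
      gaussianReal 0 (∑ i, ∑ j, c i * c j * ∫ ω, W i ω * W j ω ∂P).toNNReal := by
  obtain ⟨v, hv⟩ := h c
  have := h.aemeasurable
  have hm : AEMeasurable (fun ω => ∑ i, c i * W i ω) P := by fun_prop
  have hvar : ∫ x, x ^ 2 ∂(gaussianReal 0 v) = v := by
    have := variance_fun_id_gaussianReal (μ := 0) (v := v)
    rw [variance_of_integral_eq_zero (by fun_prop) integral_id_gaussianReal] at this
    exact this
  rw [← h.integral_sq, ← integral_map (f := fun x : ℝ => x ^ 2) hm (by fun_prop), hv, hvar]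
  simp

lemma posSemidef (h : IsCenteredGaussianFamily W P) :
    (Matrix.of fun i j => ∫ ω, W i ω * W j ω ∂P).PosSemidef := by
  refine Matrix.PosSemidef.of_dotProduct_mulVec_nonneg ?_ fun x => ?_
  · ext i j
    simp [mul_comm]
  · have := integral_nonneg (μ := P) (f := fun ω => (∑ i, x i * W i ω) ^ 2) fun ω => sq_nonneg _
    rw [h.integral_sq] at this
    simpa [dotProduct, Matrix.mulVec, mul_sum, mul_assoc, mul_comm, mul_left_comm] using this

variable [IsProbabilityMeasure P]

/-- A centered Gaussian family is in law a linear image of independent standard Gaussians. -/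
lemma exists_map_eq (h : IsCenteredGaussianFamily W P) :
    ∃ M : Matrix ι ι ℝ, (M * M.transpose = Matrix.of fun i j => ∫ ω, W i ω * W j ω ∂P) ∧
      P.map (fun ω i => W i ω) =
        (Measure.pi fun _ : ι => gaussianReal 0 1).map (fun x => M.mulVec x) := by
  classical
  set S : Matrix ι ι ℝ := Matrix.of fun i j => ∫ ω, W i ω * W j ω ∂P with hS
  have hmeas := h.aemeasurable
  have hWm : AEMeasurable (fun ω i => W i ω) P := aemeasurable_pi_lambda _ hmeas
  have hPS := h.posSemidef
  open scoped MatrixOrder in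
  have hsqrt : CFC.sqrt S * (CFC.sqrt S).transpose = S := by
    have : (CFC.sqrt S).transpose = CFC.sqrt S := by
      have := (CFC.sqrt_nonneg S).isSelfAdjoint.star_eq
      rwa [Matrix.star_eq_conjTranspose, Matrix.conjTranspose_eq_transpose_of_trivial] at this
    rw [this, CFC.sqrt_mul_sqrt_self _ hPS.nonneg]
  have hlaw : P.map (fun ω => WithLp.toLp 2 fun i => W i ω) = multivariateGaussian 0 S := by
    have hLp : AEMeasurable (fun ω => WithLp.toLp 2 fun i => W i ω) P := by fun_prop
    have := Measure.isProbabilityMeasure_map hLp (μ := P)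
    refine Measure.ext_of_charFun (E := EuclideanSpace ℝ ι) (funext fun t => ?_)
    have hm : AEMeasurable (fun ω => ∑ i, t i * W i ω) P := by fun_prop
    have hV : 0 ≤ ∑ i, ∑ j, t i * t j * ∫ ω, W i ω * W j ω ∂P :=
      h.integral_sq t ▸ integral_nonneg fun ω => sq_nonneg _
    have e1 : charFun (P.map (fun ω => WithLp.toLp 2 fun i => W i ω)) t =
        charFun (P.map (fun ω => ∑ i, t i * W i ω)) 1 := by
      rw [charFun_apply, charFun_apply_real, integral_map hLp (by fun_prop),
        integral_map hm (by fun_prop)]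
      simp [PiLp.inner_apply]
    rw [e1, h.map_eq, charFun_gaussianReal, charFun_multivariateGaussian hPS]
    have e2 : (t : ι → ℝ) ⬝ᵥ S.mulVec t = ∑ i, ∑ j, t i * t j * ∫ ω, W i ω * W j ω ∂P := by
      simp [hS, dotProduct, Matrix.mulVec, mul_sum, mul_assoc, mul_comm]
    rw [e2, Real.coe_toNNReal _ hV]
    simp
  refine ⟨CFC.sqrt S, hsqrt, ?_⟩
  have e : (fun ω i => W i ω) = WithLp.ofLp ∘ (fun ω => WithLp.toLp 2 fun i => W i ω) := rfl
  rw [e, ← AEMeasurable.map_map_of_aemeasurable (by fun_prop) (by fun_prop), hlaw,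
    multivariateGaussian, ← map_pi_eq_stdGaussian, Measure.map_map (by fun_prop) (by fun_prop),
    Measure.map_map (by fun_prop) (by fun_prop)]
  congr 1
  ext x i
  simp

/-- Polynomials in a Gaussian family are integrable. -/
lemma integrable_eval (h : IsCenteredGaussianFamily W P) (p : MvPolynomial ι ℝ) :
    Integrable (fun ω => MvPolynomial.eval (fun i => W i ω) p) P := by
  obtain ⟨M, -, hM⟩ := h.exists_map_eq
  have hcont (μ : Measure (ι → ℝ)) : AEStronglyMeasurable (fun x => MvPolynomial.eval x p) μ :=
    p.continuous_eval.aestronglyMeasurable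
  have := (p.linearSubst M).integrable_eval_pi_gaussianReal
  simp only [MvPolynomial.eval_linearSubst] at this
  have h2 : Integrable (fun x => MvPolynomial.eval x p) (P.map fun ω i => W i ω) :=
    hM ▸ (integrable_map_measure (hcont _) (by fun_prop)).2 this
  exact (integrable_map_measure (hcont _) (aemeasurable_pi_lambda _ h.aemeasurable)).1 h2

open MvPolynomial in
/-- Gaussian integration by parts for polynomials. -/
lemma integral_X_mul (h : IsCenteredGaussianFamily W P) (i : ι) (p : MvPolynomial ι ℝ) :
    ∫ ω, eval (fun i => W i ω) (X i * p) ∂P =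
      ∑ j, (∫ ω, W i ω * W j ω ∂P) * ∫ ω, eval (fun i => W i ω) (pderiv j p) ∂P := by
  obtain ⟨M, hMS, hM⟩ := h.exists_map_eq
  have := h.aemeasurable
  have hcont (q : MvPolynomial ι ℝ) (μ : Measure (ι → ℝ)) :
      AEStronglyMeasurable (fun x => eval x q) μ := q.continuous_eval.aestronglyMeasurable
  have hE (q : MvPolynomial ι ℝ) : ∫ ω, eval (fun i => W i ω) q ∂P =
      ∫ x, eval x (linearSubst M q) ∂(Measure.pi fun _ : ι => gaussianReal 0 1) := by
    rw [← integral_map (f := fun x => eval x q) (φ := fun ω i => W i ω)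
      (aemeasurable_pi_lambda _ this) (hcont _ _), hM, integral_map (by fun_prop) (hcont _ _)]
    simp only [eval_linearSubst]
  have hS (j : ι) : ∫ ω, W i ω * W j ω ∂P = ∑ k, M i k * M j k := by
    have := congrFun (congrFun hMS i) j
    simpa [Matrix.mul_apply] using this.symm
  have hX : linearSubst M (X i * p) = ∑ k, C (M i k) * (X k * linearSubst M p) := by
    rw [map_mul, linearSubst, aeval_X, sum_mul]
    simp only [mul_assoc]
  have hpd (k : ι) : pderiv k (linearSubst M p) =
      ∑ j, C (M j k) * linearSubst M (pderiv j p) := by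
    classical
    rw [linearSubst, pderiv_aeval]
    simp [pderiv_X, Pi.single_apply, mul_comm]
  have hsum (f : ι → MvPolynomial ι ℝ) (c : ι → ℝ) :
      ∫ x, eval x (∑ k, C (c k) * f k) ∂(Measure.pi fun _ : ι => gaussianReal 0 1) =
        ∑ k, c k * ∫ x, eval x (f k) ∂(Measure.pi fun _ : ι => gaussianReal 0 1) := by
    simp only [map_sum, map_mul, eval_C]
    rw [integral_finsetSum _ fun k _ => (integrable_eval_pi_gaussianReal _).const_mul _]
    simp only [integral_const_mul]
  simp_rw [hE, hX, hsum, integral_X_mul_pi_gaussianReal, hpd, hsum, hS, mul_sum, sum_mul]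
  rw [sum_comm]
  simp only [mul_assoc]

end IsCenteredGaussianFamily
end GaussianFamily

section DiagramBound

/-- Weighted number of complete diagrams between rows of sizes `p + m'` and `q + m`. -/
noncomputable def diagramWeight (x y : ℝ) (p q m : ℕ) : ℝ :=
  ∑ rs ∈ antidiagonal p, (p.choose rs.1 : ℝ) *
    (q.descFactorial rs.1 * m.descFactorial rs.2 * x ^ rs.1 * y ^ rs.2 * y ^ (q - rs.1))

lemma diagramWeight_zero (x y : ℝ) (q m : ℕ) : diagramWeight x y 0 q m = y ^ q := by
  simp [diagramWeight]

lemma diagramWeight_succ (x y : ℝ) (p q m : ℕ) :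
    diagramWeight x y (p + 1) q m =
      y * m * diagramWeight x y p q (m - 1) + x * q * diagramWeight x y p (q - 1) m := by
  have hdesc (n k : ℕ) : (n.descFactorial (k + 1) : ℝ) = n * (n - 1).descFactorial k := by
    rcases n with _ | n
    · simp
    · rw [Nat.succ_descFactorial_succ, Nat.cast_mul, Nat.add_sub_cancel]
  rw [diagramWeight, sum_antidiagonal_choose_succ_mul
    (fun r s => (q.descFactorial r * m.descFactorial s * x ^ r * y ^ s * y ^ (q - r) : ℝ)),
    diagramWeight, diagramWeight, mul_sum, mul_sum]
  congr 1
  · refine sum_congr rfl fun rs _ => ?_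
    rw [hdesc]
    ring
  · refine sum_congr rfl fun rs hrs => ?_
    rw [← Nat.choose_symm_of_eq_add (mem_antidiagonal.1 hrs).symm, hdesc,
      show q - (rs.1 + 1) = q - 1 - rs.1 by omega]
    ring

lemma factorial_mul_diagramWeight_self (x y : ℝ) (p m : ℕ) :
    m.factorial * diagramWeight x y p p m = ((p.factorial : ℝ) * m.factorial) ^ 2 *
      ∑ r ∈ Icc (p - m) p, x ^ r * y ^ (2 * (p - r)) /
        ((r.factorial : ℝ) * (p - r).factorial * (p - r).factorial * (m - (p - r)).factorial) := by
  rw [diagramWeight, Nat.sum_antidiagonal_eq_sum_range_succ_mk, mul_sum, mul_sum]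
  symm
  refine sum_subset_zero_on_sdiff (fun r hr => ?_) (fun r hr => ?_) fun r hr => ?_
  · simp only [mem_Icc, mem_range] at *
    omega
  · simp only [mem_sdiff, mem_Icc, mem_range] at hr
    have : m.descFactorial (p - r) = 0 := Nat.descFactorial_eq_zero_iff_lt.2 (by omega)
    simp [this]
  · rw [mem_Icc] at hr
    obtain ⟨s, rfl⟩ := Nat.exists_eq_add_of_le hr.2
    obtain ⟨t, rfl⟩ := Nat.exists_eq_add_of_le (show s ≤ m by omega)
    have h1 : ((r + s).choose r : ℝ) * r.factorial * s.factorial = (r + s).factorial := by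
      have := Nat.choose_mul_factorial_mul_factorial (Nat.le_add_right r s)
      rw [Nat.add_sub_cancel_left] at this
      exact_mod_cast this
    have h2 : (s.factorial : ℝ) * (r + s).descFactorial r = (r + s).factorial := by
      have := Nat.factorial_mul_descFactorial (Nat.le_add_right r s)
      rw [Nat.add_sub_cancel_left] at this
      exact_mod_cast this
    have h3 : (t.factorial : ℝ) * (s + t).descFactorial s = (s + t).factorial := by
      have := Nat.factorial_mul_descFactorial (Nat.le_add_right s t)
      rw [Nat.add_sub_cancel_left] at this
      exact_mod_cast this
    simp only [Nat.add_sub_cancel_left]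
    have := r.factorial_pos
    have := s.factorial_pos
    have := t.factorial_pos
    rw [mul_div_assoc', div_eq_iff (by positivity), mul_pow, sq (((r + s).factorial : ℝ))]
    nth_rw 1 [← h1]
    rw [← h2, ← h3]
    ring

variable {κ : Type*} [Fintype κ] [DecidableEq κ]

lemma abs_sum_option_le (c : Option κ → ℝ) {u v F₀ F₁ : ℝ} (hc₀ : |c none| ≤ u)
    (hc₁ : ∀ k, |c (some k)| ≤ v) (b : Option κ → ℕ) (f : (Option κ → ℕ) → ℝ)
    (h₀ : ∀ b', b = b' + Pi.single none 1 → |f b'| ≤ F₀)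
    (h₁ : ∀ b' k, b = b' + Pi.single (some k) 1 → |f b'| ≤ F₁) :
    |∑ j, c j * b j * f (b - Pi.single j 1)| ≤
      u * b none * F₀ + v * (∑ k, b (some k) : ℕ) * F₁ := by
  have hsub (j : Option κ) (hj : b j ≠ 0) : b = (b - Pi.single j 1) + Pi.single j 1 := by
    refine (tsub_add_cancel_of_le fun i => ?_).symm
    rcases eq_or_ne i j with rfl | hi
    · simpa using Nat.one_le_iff_ne_zero.2 hj
    · simp [hi]
  have hterm (j : Option κ) (w F : ℝ) (hw : |c j| ≤ w)
      (hF : b j ≠ 0 → |f (b - Pi.single j 1)| ≤ F) :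
      |c j * b j * f (b - Pi.single j 1)| ≤ w * b j * F := by
    rcases eq_or_ne (b j) 0 with hj | hj
    · simp [hj]
    · have hw0 : 0 ≤ w := (abs_nonneg _).trans hw
      rw [abs_mul, abs_mul, Nat.abs_cast]
      gcongr
      exact hF hj
  rw [Fintype.sum_option, Nat.cast_sum, mul_sum, sum_mul]
  refine (abs_add_le _ _).trans (add_le_add (hterm _ _ _ hc₀ fun hj => h₀ _ (hsub _ hj)) ?_)
  exact (abs_sum_le_sum_abs _ _).trans
    (sum_le_sum fun k _ => hterm _ _ _ (hc₁ k) fun hj => h₁ _ k (hsub _ hj))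

/-- A function of two multi-indices obeying the recursion of the diagram formula is bounded by the
weighted number of complete diagrams. -/
lemma abs_le_diagramWeight {M : (Option κ → ℕ) → (Option κ → ℕ) → ℝ}
    {c : Option κ → Option κ → ℝ} {x y : ℝ}
    (hM₀ : M 0 0 = 1)
    (hM : ∀ a b i, M (a + Pi.single i 1) b = ∑ j, c i j * b j * M a (b - Pi.single j 1))
    (hx : ∀ k l, |c (some k) (some l)| ≤ x) (hy : ∀ k, |c (some k) none| ≤ y)
    (hy' : ∀ k, |c none (some k)| ≤ y) (h₁ : |c none none| ≤ 1) (p m : ℕ)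
    (a b : Option κ → ℕ) (hp : ∑ k, a (some k) = p) (hm : a none = m)
    (hab : p + m = ∑ k, b (some k) + b none) :
    |M a b| ≤ m.factorial * diagramWeight x y p (∑ k, b (some k)) (b none) := by
  have hsum_none (b' : Option κ → ℕ) :
      ∑ k, (b' + Pi.single none 1 : Option κ → ℕ) (some k) = ∑ k, b' (some k) := by simp
  have hsum_some (b' : Option κ → ℕ) (k : κ) :
      ∑ l, (b' + Pi.single (some k) 1 : Option κ → ℕ) (some l) = ∑ l, b' (some l) + 1 := by
    simp [sum_add_distrib, Pi.single_apply]
  induction p generalizing a b with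
  | zero =>
    rw [diagramWeight_zero]
    obtain rfl : a = Pi.single none m := by
      ext (_ | k)
      · simpa using hm
      · simpa using (sum_eq_zero_iff.1 hp) k (mem_univ k)
    clear hp hm
    induction m generalizing b with
    | zero =>
      have hb : b = 0 := by
        ext (_ | k)
        · simp only [Pi.zero_apply]
          omega
        · exact (sum_eq_zero_iff.1 (by omega : ∑ k, b (some k) = 0)) k (mem_univ k)
      simp [hb, hM₀]
    | succ m ih =>
      rw [Pi.single_add, hM]
      refine (abs_sum_option_le (c none) (F₀ := m.factorial * y ^ ∑ k, b (some k))
        (F₁ := m.factorial * y ^ (∑ k, b (some k) - 1)) h₁ hy' b _ ?_ ?_).trans (le_of_eq ?_)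
      · rintro b' rfl
        rw [hsum_none] at hab ⊢
        refine ih b' ?_
        simp only [Pi.add_apply, Pi.single_eq_same] at hab
        omega
      · rintro b' k rfl
        rw [hsum_some] at hab ⊢
        refine ih b' ?_
        simp only [Pi.add_apply, Pi.single_apply, reduceCtorEq, if_false] at hab
        omega
      · have hpow : y * (∑ k, b (some k) : ℕ) * (m.factorial * y ^ (∑ k, b (some k) - 1)) =
            (∑ k, b (some k) : ℕ) * (m.factorial * y ^ ∑ k, b (some k)) := by
          rcases ∑ k, b (some k) with _ | q
          · simp
          · rw [Nat.add_sub_cancel]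
            ring
        have hab' : ((m + 1 : ℕ) : ℝ) = (∑ k, b (some k) : ℕ) + (b none : ℕ) := by
          rw [← Nat.cast_add]
          congr 1
          omega
        rw [hpow, Nat.factorial_succ, Nat.cast_mul, hab']
        ring
  | succ p ih =>
    obtain ⟨k, hk⟩ : ∃ k, a (some k) ≠ 0 := by
      by_contra! h
      simp [h] at hp
    obtain ⟨a', rfl⟩ : ∃ a', a = a' + Pi.single (some k) 1 := by
      refine ⟨a - Pi.single (some k) 1, (tsub_add_cancel_of_le fun i => ?_).symm⟩
      rcases eq_or_ne i (some k) with rfl | hi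
      · simpa using Nat.one_le_iff_ne_zero.2 hk
      · simp [hi]
    rw [hsum_some] at hp
    replace hp : ∑ k, a' (some k) = p := by omega
    replace hm : a' none = m := by simpa using hm
    rw [hM]
    refine (abs_sum_option_le (c (some k))
      (F₀ := m.factorial * diagramWeight x y p (∑ k, b (some k)) (b none - 1))
      (F₁ := m.factorial * diagramWeight x y p (∑ k, b (some k) - 1) (b none))
      (hy k) (hx k) b _ ?_ ?_).trans (le_of_eq ?_)
    · rintro b' rfl
      rw [hsum_none] at hab ⊢
      simp only [Pi.add_apply, Pi.single_eq_same, Nat.add_sub_cancel] at hab ⊢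
      exact ih a' b' hp hm (by omega)
    · rintro b' l rfl
      rw [hsum_some] at hab ⊢
      simp only [Pi.add_apply, Pi.single_apply, reduceCtorEq, if_false, add_zero,
        Nat.add_sub_cancel] at hab ⊢
      exact ih a' b' hp hm (by omega)
    · rw [diagramWeight_succ]
      ring

end DiagramBound

section HermiteMoments

open MvPolynomial

lemma pderiv_aeval_X {ι : Type*} [DecidableEq ι] (P : Polynomial ℤ) (i j : ι) :
    pderiv j (Polynomial.aeval (X i : MvPolynomial ι ℝ) P) =
      if i = j then Polynomial.aeval (X i) (Polynomial.derivative P) else 0 := by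
  have := ((pderiv j : Derivation ℝ (MvPolynomial ι ℝ) _).restrictScalars ℤ).map_aeval P (X i)
  simp only [Derivation.restrictScalars_apply, pderiv_X, Pi.single_apply, smul_eq_mul] at this
  rw [this]
  split_ifs <;> simp_all

/-- Product of probabilists' Hermite polynomials in the variables. -/
noncomputable def hermiteProd {ι : Type*} [Fintype ι] (α : ι → ℕ) : MvPolynomial ι ℝ :=
  ∏ i, Polynomial.aeval (X i) (Polynomial.hermite (α i))

variable {ι : Type*} [Fintype ι]

lemma eval_hermiteProd (α : ι → ℕ) (x : ι → ℝ) :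
    eval x (hermiteProd α) = ∏ i, hermiteEval (α i) (x i) := by
  rw [hermiteProd, map_prod]
  refine prod_congr rfl fun i _ => ?_
  rw [hermiteEval, Polynomial.aeval_def, Polynomial.aeval_def, Polynomial.hom_eval₂, eval_X]
  congr 1
  exact Subsingleton.elim _ _

variable [DecidableEq ι]

lemma hermiteProd_eq_mul (α : ι → ℕ) (j : ι) :
    hermiteProd α = Polynomial.aeval (X j) (Polynomial.hermite (α j)) *
      ∏ i ∈ univ.erase j, Polynomial.aeval (X i : MvPolynomial ι ℝ) (Polynomial.hermite (α i)) :=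
  (mul_prod_erase _ _ (mem_univ j)).symm

lemma pderiv_hermiteProd_eq_mul (α : ι → ℕ) (j : ι) :
    pderiv j (hermiteProd α) =
      Polynomial.aeval (X j) (Polynomial.derivative (Polynomial.hermite (α j))) *
      ∏ i ∈ univ.erase j, Polynomial.aeval (X i : MvPolynomial ι ℝ) (Polynomial.hermite (α i)) := by
  have h0 : pderiv j (∏ i ∈ univ.erase j,
      Polynomial.aeval (X i : MvPolynomial ι ℝ) (Polynomial.hermite (α i))) = 0 := by
    refine prod_induction _ (fun q => pderiv j q = 0) (fun p q hp hq => ?_) (by simp)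
      fun i hi => ?_
    · rw [pderiv_mul, hp, hq, zero_mul, mul_zero, add_zero]
    · rw [pderiv_aeval_X, if_neg (ne_of_mem_erase hi)]
  rw [hermiteProd_eq_mul α j, pderiv_mul, h0, pderiv_aeval_X, if_pos rfl, mul_zero, add_zero]

lemma pderiv_hermiteProd (α : ι → ℕ) (j : ι) :
    pderiv j (hermiteProd α) = C (α j : ℝ) * hermiteProd (α - Pi.single j 1) := by
  rw [pderiv_hermiteProd_eq_mul, hermiteProd_eq_mul (α - Pi.single j 1) j, derivative_hermite]
  have : ∏ i ∈ univ.erase j, Polynomial.aeval (X i : MvPolynomial ι ℝ)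
      (Polynomial.hermite ((α - Pi.single j 1 : ι → ℕ) i)) = ∏ i ∈ univ.erase j,
        Polynomial.aeval (X i : MvPolynomial ι ℝ) (Polynomial.hermite (α i)) :=
    prod_congr rfl fun i hi => by simp [ne_of_mem_erase hi]
  rw [this]
  simp [mul_assoc]

lemma hermiteProd_add_single (α : ι → ℕ) (j : ι) :
    hermiteProd (α + Pi.single j 1) = X j * hermiteProd α - pderiv j (hermiteProd α) := by
  rw [pderiv_hermiteProd_eq_mul, hermiteProd_eq_mul (α + Pi.single j 1) j, hermiteProd_eq_mul α j]
  have : ∏ i ∈ univ.erase j, Polynomial.aeval (X i : MvPolynomial ι ℝ)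
      (Polynomial.hermite ((α + Pi.single j 1 : ι → ℕ) i)) = ∏ i ∈ univ.erase j,
        Polynomial.aeval (X i : MvPolynomial ι ℝ) (Polynomial.hermite (α i)) :=
    prod_congr rfl fun i hi => by simp [ne_of_mem_erase hi]
  rw [this, Pi.add_apply, Pi.single_eq_same, Polynomial.hermite_succ]
  simp only [map_sub, map_mul, Polynomial.aeval_X]
  ring

/-- Recursion of the diagram formula. -/
lemma IsCenteredGaussianFamily.integral_hermiteProd_add_single {Ω : Type*} [MeasurableSpace Ω]
    {P : Measure Ω} [IsProbabilityMeasure P] {W : ι → Ω → ℝ} (h : IsCenteredGaussianFamily W P)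
    (α : ι → ℕ) (i : ι) (hi : ∫ ω, W i ω * W i ω ∂P = 1) :
    ∫ ω, eval (fun i => W i ω) (hermiteProd (α + Pi.single i 1)) ∂P =
      ∑ j ∈ univ.erase i, (∫ ω, W i ω * W j ω ∂P) * α j *
        ∫ ω, eval (fun i => W i ω) (hermiteProd (α - Pi.single j 1)) ∂P := by
  have hpd (j : ι) : ∫ ω, eval (fun i => W i ω) (pderiv j (hermiteProd α)) ∂P =
      α j * ∫ ω, eval (fun i => W i ω) (hermiteProd (α - Pi.single j 1)) ∂P := by
    simp only [pderiv_hermiteProd, map_mul, eval_C, integral_const_mul]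
  rw [hermiteProd_add_single]
  simp_rw [map_sub]
  rw [integral_sub (h.integrable_eval _) (h.integrable_eval _), h.integral_X_mul,
    ← add_sum_erase _ _ (mem_univ i), hi, one_mul, add_sub_cancel_left]
  simp_rw [hpd, mul_assoc]

end HermiteMoments

/-- Diagram-formula bound on mixed moments of products of Hermite polynomials of a jointly
Gaussian family `(A, B, Ã, B̃)` with standard marginals `(Aᵀ,B)ᵀ` and `(Ãᵀ,B̃)ᵀ`. -/
theorem stmt_6 {Ω : Type*} [MeasurableSpace Ω] (P : Measure Ω) [IsProbabilityMeasure P]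
    (K : ℕ) (A A' : Fin K → Ω → ℝ) (B B' : Ω → ℝ)
    -- joint Gaussianity: every linear combination is centered Gaussian
    (hGauss : ∀ (c c' : Fin K → ℝ) (b b' : ℝ), ∃ v : NNReal,
      P.map (fun ω => (∑ k, c k * A k ω) + b * B ω + (∑ k, c' k * A' k ω) + b' * B' ω)
        = ProbabilityTheory.gaussianReal 0 v)
    -- each marginal vector is standard multivariate normal
    (hstd₁ : ∀ k l, ∫ ω, A k ω * A l ω ∂P = if k = l then 1 else 0)
    (hstd₂ : ∀ k, ∫ ω, A k ω * B ω ∂P = 0) (hstd₃ : ∫ ω, B ω * B ω ∂P = 1)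
    (hstd₁' : ∀ k l, ∫ ω, A' k ω * A' l ω ∂P = if k = l then 1 else 0)
    (hstd₂' : ∀ k, ∫ ω, A' k ω * B' ω ∂P = 0) (hstd₃' : ∫ ω, B' ω * B' ω ∂P = 1)
    -- bounds on the cross-covariances
    (σAA σAB : ℝ) (hσAA₀ : 0 ≤ σAA) (hσAB₀ : 0 ≤ σAB)
    (hAA : ∀ k l, |∫ ω, A k ω * A' l ω ∂P| ≤ σAA)
    (hAB : ∀ k, |∫ ω, A k ω * B' ω ∂P| ≤ σAB)
    (hBA : ∀ k, |∫ ω, B ω * A' k ω ∂P| ≤ σAB)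
    (hBB : |∫ ω, B ω * B' ω ∂P| ≤ 1)
    (a : Fin K → ℕ) (a₀ m : ℕ) (ha₀ : a₀ = ∑ k, a k) :
    |∫ ω, (∏ k, hermiteEval (a k) (A k ω)) * hermiteEval m (B ω) *
        (∏ k, hermiteEval (a k) (A' k ω)) * hermiteEval m (B' ω) ∂P| ≤
      ((a₀.factorial : ℝ) * m.factorial) ^ 2 *
        ∑ r ∈ Finset.Icc (a₀ - m) a₀,
          σAA ^ r * σAB ^ (2 * (a₀ - r)) /
            ((r.factorial : ℝ) * (a₀ - r).factorial * (a₀ - r).factorial *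
              (m - (a₀ - r)).factorial) := by
  classical
  set W : Option (Fin K) ⊕ Option (Fin K) → Ω → ℝ :=
    Sum.elim (fun o => o.elim B A) (fun o => o.elim B' A') with hWdef
  have hW : IsCenteredGaussianFamily W P := fun c => by
    obtain ⟨v, hv⟩ := hGauss (fun k => c (.inl (some k))) (fun k => c (.inr (some k)))
      (c (.inl none)) (c (.inr none))
    refine ⟨v, ?_⟩
    rw [← hv]
    congr with ω
    simp only [hWdef, Fintype.sum_sum_type, Fintype.sum_option, Sum.elim_inl, Sum.elim_inr,
      Option.elim]
    ring
  have hstd (i j : Option (Fin K)) :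
      ∫ ω, W (.inl i) ω * W (.inl j) ω ∂P = if i = j then 1 else 0 := by
    rcases i with _ | i <;> rcases j with _ | j
    · simpa [hWdef] using hstd₃
    · simpa [hWdef, mul_comm] using hstd₂ j
    · simpa [hWdef] using hstd₂ i
    · simpa [hWdef] using hstd₁ i j
  set M : (Option (Fin K) → ℕ) → (Option (Fin K) → ℕ) → ℝ := fun a b =>
    ∫ ω, MvPolynomial.eval (fun i => W i ω) (hermiteProd (Sum.elim a b)) ∂P with hMdef
  have hM₀ : M 0 0 = 1 := by simp [hMdef, hermiteProd]
  have hM (a b : Option (Fin K) → ℕ) (i : Option (Fin K)) : M (a + Pi.single i 1) b =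
      ∑ j, (∫ ω, W (.inl i) ω * W (.inr j) ω ∂P) * b j * M a (b - Pi.single j 1) := by
    have hadd : Sum.elim (a + Pi.single i 1) b = Sum.elim a b + Pi.single (.inl i) 1 := by
      ext (j | j) <;> simp [Pi.single_apply]
    have hsub (j : Option (Fin K)) :
        Sum.elim a b - Pi.single (.inr j) 1 = Sum.elim a (b - Pi.single j 1) := by
      ext (k | k) <;> simp [Pi.single_apply]
    simp only [hMdef]
    rw [hadd, hW.integral_hermiteProd_add_single _ _ (by simp [hstd])]
    simp only [← hsub]
    refine (sum_subset (s₁ := (univ : Finset (Option (Fin K))).map Function.Embedding.inr)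
      (fun j hj => ?_) fun j hj hj' => ?_).symm.trans (sum_map _ _ _)
    · obtain ⟨k, -, rfl⟩ := mem_map.1 hj
      simp
    · rcases j with j | j
      · rw [hstd, if_neg (by rintro rfl; simp at hj), zero_mul, zero_mul]
      · simp at hj'
  have key := abs_le_diagramWeight hM₀ hM hAA hAB hBA hBB a₀ m (fun o => o.elim m a)
    (fun o => o.elim m a) ha₀.symm rfl (by simp [ha₀])
  simp only [Option.elim, ← ha₀, factorial_mul_diagramWeight_self] at key
  convert key using 2
  simp only [hMdef, eval_hermiteProd]
  congr with ω
  simp only [hWdef, Fintype.prod_sum_type, Fintype.prod_option, Sum.elim_inl, Sum.elim_inr,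
    Option.elim]
  ring
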